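/- arXiv:1207.3565 — 5 statements merged into one kernel-verified Lean document; each statement's English description precedes it below -/
import Mathlib

section
/- Let T > 0, let f : [0,T] → ℝ^d be a measurable function with ‖f(s)‖ ≤ M for all s ∈ [0,T], let x ∈ ℝ^d, and let 0 < ε < T. If ∫_0^T ‖x + ∫_0^t f(s) ds‖² dt ≤ ε³, then sup_{t∈[0,T]} ‖∫_0^t f(s) ds‖ ≤ 2(1 + M)ε. -/
open MeasureTheory

/-- A continuous function on `[0, T]` with `∫ ‖g‖² ≤ ε³` has norm at most `ε` somewhere on
each subinterval of length `ε`. -/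
lemma exists_norm_le_of_integral_sq_le {E : Type*} [NormedAddCommGroup E] {T ε a : ℝ}
    {g : ℝ → E} (hg : ContinuousOn g (Set.Icc 0 T)) (hε : 0 < ε) (ha : 0 ≤ a)
    (haT : a + ε ≤ T) (h : (∫ t in (0 : ℝ)..T, ‖g t‖ ^ 2) ≤ ε ^ 3) :
    ∃ s ∈ Set.Icc a (a + ε), ‖g s‖ ≤ ε := by
  by_contra! hlt
  have hT : 0 ≤ T := by linarith
  have hsub : Set.Icc a (a + ε) ⊆ Set.Icc 0 T := Set.Icc_subset_Icc ha haT
  have hg2 : ContinuousOn (fun t => ‖g t‖ ^ 2) (Set.Icc 0 T) := hg.norm.pow 2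
  have hsq : ∀ s ∈ Set.Icc a (a + ε), ε ^ 2 < ‖g s‖ ^ 2 := fun s hs =>
    pow_lt_pow_left₀ (hlt s hs) hε.le two_ne_zero
  have hstrict : (∫ _ in a..(a + ε), ε ^ 2) < ∫ t in a..(a + ε), ‖g t‖ ^ 2 :=
    intervalIntegral.integral_lt_integral_of_continuousOn_of_le_of_exists_lt (by linarith)
      continuousOn_const (hg2.mono hsub)
      (fun s hs => (hsq s (Set.Ioc_subset_Icc_self hs)).le)
      ⟨a, ⟨le_rfl, by linarith⟩, hsq a ⟨le_rfl, by linarith⟩⟩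
  have hmono : (∫ t in a..(a + ε), ‖g t‖ ^ 2) ≤ ∫ t in (0 : ℝ)..T, ‖g t‖ ^ 2 :=
    intervalIntegral.integral_mono_interval ha (by linarith) haT
      (Filter.Eventually.of_forall fun t => by positivity)
      (hg2.intervalIntegrable_of_Icc hT)
  rw [intervalIntegral.integral_const, smul_eq_mul] at hstrict
  nlinarith

/-- A Lipschitz function on `[0, T]` with small `L²` norm is uniformly small. -/
lemma norm_le_of_lipschitz_of_integral_sq_le {E : Type*} [NormedAddCommGroup E] {T M ε : ℝ}
    {g : ℝ → E} (hM : 0 ≤ M)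
    (hg : ∀ s ∈ Set.Icc 0 T, ∀ t ∈ Set.Icc 0 T, ‖g t - g s‖ ≤ M * |t - s|)
    (hε : 0 < ε) (hεT : ε ≤ T) (h : (∫ t in (0 : ℝ)..T, ‖g t‖ ^ 2) ≤ ε ^ 3)
    {t : ℝ} (ht : t ∈ Set.Icc 0 T) : ‖g t‖ ≤ (1 + M) * ε := by
  have hcont : ContinuousOn g (Set.Icc 0 T) := by
    refine (LipschitzOnWith.of_dist_le_mul (K := ⟨M, hM⟩) fun s hs u hu => ?_).continuousOn
    rw [dist_eq_norm, Real.dist_eq]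
    exact hg u hu s hs
  have ha : 0 ≤ min t (T - ε) := le_min ht.1 (by linarith)
  have haT : min t (T - ε) + ε ≤ T := by linarith [min_le_right t (T - ε)]
  obtain ⟨s, hs, hsε⟩ := exists_norm_le_of_integral_sq_le hcont hε ha haT h
  have hts : |t - s| ≤ ε := by
    have h1 := min_le_left t (T - ε)
    have h2 : t ≤ min t (T - ε) + ε := by
      rcases min_choice t (T - ε) with h3 | h3 <;> rw [h3] <;> linarith [ht.2]
    rw [abs_le]
    constructor <;> linarith [hs.1, hs.2]
  have hgs := hg s ⟨ha.trans hs.1, hs.2.trans haT⟩ t ht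
  have htri := norm_sub_norm_le (g t) (g s)
  have := mul_le_mul_of_nonneg_left hts hM
  linarith

/-- Norris-type deterministic lemma (Lemma 3.3 in the paper): if a bounded measurable
`f : [0,T] → ℝ^d` satisfies `∫_0^T ‖x + ∫_0^t f(s) ds‖² dt ≤ ε³` with `0 < ε < T`, then
`sup_{t ∈ [0,T]} ‖∫_0^t f(s) ds‖ ≤ 2(1+M)ε`. -/
theorem stmt0 {d : ℕ} (T M : ℝ) (hT : 0 < T)
    (f : ℝ → EuclideanSpace ℝ (Fin d)) (hf : Measurable f)
    (hbound : ∀ s ∈ Set.Icc (0 : ℝ) T, ‖f s‖ ≤ M)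
    (x : EuclideanSpace ℝ (Fin d)) (ε : ℝ) (hε : 0 < ε) (hεT : ε < T)
    (h : (∫ t in (0 : ℝ)..T, ‖x + ∫ s in (0 : ℝ)..t, f s‖ ^ 2) ≤ ε ^ 3) :
    ∀ t ∈ Set.Icc (0 : ℝ) T, ‖∫ s in (0 : ℝ)..t, f s‖ ≤ 2 * (1 + M) * ε := by
  have h0 : (0 : ℝ) ∈ Set.Icc 0 T := ⟨le_rfl, hT.le⟩
  have hM : 0 ≤ M := (norm_nonneg _).trans (hbound 0 h0)
  have hint : ∀ t ∈ Set.Icc 0 T, IntervalIntegrable f volume 0 t := fun t ht => by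
    rw [intervalIntegrable_iff_integrableOn_Icc_of_le ht.1]
    exact Measure.integrableOn_of_bounded (M := M) measure_Icc_lt_top.ne
      hf.aestronglyMeasurable <| (ae_restrict_iff' measurableSet_Icc).2 <|
        Filter.Eventually.of_forall fun s hs => hbound s ⟨hs.1, hs.2.trans ht.2⟩
  have hlip : ∀ s ∈ Set.Icc 0 T, ∀ t ∈ Set.Icc 0 T,
      ‖(x + ∫ r in (0 : ℝ)..t, f r) - (x + ∫ r in (0 : ℝ)..s, f r)‖ ≤ M * |t - s| := by
    intro s hs t ht
    rw [add_sub_add_left_eq_sub,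
      intervalIntegral.integral_interval_sub_left (hint t ht) (hint s hs)]
    exact intervalIntegral.norm_integral_le_of_norm_le_const fun r hr =>
      hbound r (Set.uIcc_subset_Icc hs ht (Set.uIoc_subset_uIcc hr))
  intro t ht
  have hgt := norm_le_of_lipschitz_of_integral_sq_le hM hlip hε hεT.le h ht
  have hg0 := norm_le_of_lipschitz_of_integral_sq_le hM hlip hε hεT.le h h0
  rw [intervalIntegral.integral_same, add_zero] at hg0
  have htri := norm_sub_le (x + ∫ s in (0 : ℝ)..t, f s) x
  rw [add_sub_cancel_left] at htri
  linarith
end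

section
/- Let b : ℝ^d → ℝ^d be Lipschitz, let g : [0,∞) → ℝ^d be right-continuous with left limits (càdlàg) with g_0 = 0, and let x ∈ ℝ^d. Then there exists a unique function X : [0,∞) → ℝ^d, measurable and bounded on compact intervals, such that X_t = x + ∫_0^t b(X_s) ds + g_t for all t ≥ 0; moreover X is càdlàg. -/
open MeasureTheory Filter

section

variable {E : Type*} [NormedAddCommGroup E]

/-- Measurable functions on the line that are bounded on every interval `[0, R]`. -/
def MeasurableLocallyBounded [MeasurableSpace E] (f : ℝ → E) : Prop :=
  Measurable f ∧ ∀ R > (0 : ℝ), ∃ C, ∀ t ∈ Set.Icc (0 : ℝ) R, ‖f t‖ ≤ C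

/-- A function on the line which is right-continuous everywhere is Borel measurable. -/
theorem measurable_of_continuousWithinAt_Ici [MeasurableSpace E] [BorelSpace E] {f : ℝ → E}
    (hf : ∀ t, ContinuousWithinAt f (Set.Ici t) t) : Measurable f := by
  let r : ℕ → ℝ → ℝ := fun n t => ((⌊((n : ℝ) + 1) * t⌋ : ℝ) + 1) / ((n : ℝ) + 1)
  have hpos (n : ℕ) : (0 : ℝ) < (n : ℝ) + 1 := by positivity
  have hr_ge (n : ℕ) (t : ℝ) : t ≤ r n t := by
    rw [le_div_iff₀ (hpos n), mul_comm]
    exact (Int.lt_floor_add_one _).le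
  have hr_le (n : ℕ) (t : ℝ) : r n t ≤ t + 1 / ((n : ℝ) + 1) := by
    have h := Int.floor_le (((n : ℝ) + 1) * t)
    have hn := hpos n
    rw [div_le_iff₀ hn, add_mul t, div_mul_cancel₀ _ hn.ne']
    linarith
  refine measurable_of_tendsto_metrizable (f := fun n t => f (r n t)) (fun n => ?_) ?_
  · have h : Measurable fun z : ℤ => f (((z : ℝ) + 1) / ((n : ℝ) + 1)) := measurable_from_top
    exact h.comp (Int.measurable_floor.comp (measurable_const_mul _))
  · rw [tendsto_pi_nhds]
    intro t
    refine (hf t).tendsto.comp (tendsto_nhdsWithin_iff.2 ⟨?_, .of_forall fun n => hr_ge n t⟩)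
    refine tendsto_of_tendsto_of_tendsto_of_le_of_le tendsto_const_nhds ?_
      (fun n => hr_ge n t) (fun n => hr_le n t)
    simpa using (tendsto_const_nhds (x := t)).add (tendsto_one_div_add_atTop_nhds_zero_nat (𝕜 := ℝ))

/-- A càdlàg function on `[0, ∞)` is bounded on every interval `[0, R]`. -/
theorem exists_norm_le_of_cadlag {f : ℝ → E}
    (hrc : ∀ t ≥ (0 : ℝ), ContinuousWithinAt f (Set.Ici t) t)
    (hll : ∀ t > (0 : ℝ), ∃ y, Tendsto f (nhdsWithin t (Set.Iio t)) (nhds y)) (R : ℝ) :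
    ∃ C, ∀ t ∈ Set.Icc (0 : ℝ) R, ‖f t‖ ≤ C := by
  refine isCompact_Icc.induction_on (p := fun s => ∃ C, ∀ t ∈ s, ‖f t‖ ≤ C) ⟨0, by simp⟩
    (fun s t hst ⟨C, hC⟩ => ⟨C, fun u hu => hC u (hst hu)⟩) ?_ ?_
  · rintro s t ⟨C, hC⟩ ⟨D, hD⟩
    refine ⟨max C D, fun u hu => hu.elim (fun h => (hC u h).trans (le_max_left _ _))
      (fun h => (hD u h).trans (le_max_right _ _))⟩
  · intro t ht
    have hbdd {l : Filter ℝ} {y : E} (h : Tendsto f l (nhds y)) : ∀ᶠ u in l, ‖f u‖ ≤ ‖y‖ + 1 :=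
      (h.norm.eventually_lt_const (lt_add_one _)).mono fun _ h => h.le
    have hright := hbdd (hrc t ht.1).tendsto
    obtain ⟨D, hD⟩ : ∃ D, ∀ᶠ u in nhdsWithin t (Set.Iio t), 0 ≤ u → ‖f u‖ ≤ D := by
      rcases ht.1.eq_or_lt with rfl | h
      · exact ⟨0, eventually_nhdsWithin_of_forall fun u hu h => absurd h (not_le.2 hu)⟩
      · obtain ⟨y, hy⟩ := hll t h
        exact ⟨_, (hbdd hy).mono fun u hu _ => hu⟩
    rw [eventually_nhdsWithin_iff] at hright hD
    refine ⟨Set.Icc 0 R ∩ {u | ‖f u‖ ≤ max (‖f t‖ + 1) D},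
      ?_,
      max (‖f t‖ + 1) D, fun u hu => hu.2⟩
    filter_upwards [self_mem_nhdsWithin, mem_nhdsWithin_of_mem_nhds hright,
      mem_nhdsWithin_of_mem_nhds hD] with u hu hu_right hu_left
    refine ⟨hu, ?_⟩
    rcases le_or_gt t u with h | h
    · exact (hu_right h).trans (le_max_left _ _)
    · exact (hu_left h hu.1).trans (le_max_right _ _)

namespace MeasurableLocallyBounded

variable [MeasurableSpace E] [BorelSpace E] {f h : ℝ → E}

protected theorem add [SecondCountableTopology E] (hf : MeasurableLocallyBounded f) (hh : MeasurableLocallyBounded h) :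
    MeasurableLocallyBounded fun t => f t + h t := by
  refine ⟨hf.1.add hh.1, fun R hR => ?_⟩
  obtain ⟨C, hC⟩ := hf.2 R hR
  obtain ⟨D, hD⟩ := hh.2 R hR
  exact ⟨C + D, fun t ht => norm_add_le_of_le (hC t ht) (hD t ht)⟩

theorem of_continuous (hf : Continuous f) : MeasurableLocallyBounded f :=
  ⟨hf.measurable, fun _ _ => isCompact_Icc.exists_bound_of_continuousOn hf.continuousOn⟩

theorem comp_lipschitz {b : E → E} {K : NNReal} (hb : LipschitzWith K b)
    (hf : MeasurableLocallyBounded f) : MeasurableLocallyBounded fun t => b (f t) := by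
  refine ⟨hb.continuous.measurable.comp hf.1, fun R hR => ?_⟩
  obtain ⟨C, hC⟩ := hf.2 R hR
  refine ⟨K * C + ‖b 0‖, fun t ht => ?_⟩
  have h := hb.norm_sub_le (f t) 0
  rw [sub_zero] at h
  calc ‖b (f t)‖ ≤ ‖b (f t) - b 0‖ + ‖b 0‖ := by simpa using norm_add_le (b (f t) - b 0) (b 0)
    _ ≤ K * C + ‖b 0‖ := by gcongr; exact h.trans (by gcongr; exact hC t ht)

theorem intervalIntegrable [SecondCountableTopology E] (hf : MeasurableLocallyBounded f)
    {s t : ℝ} (hs : 0 ≤ s) (ht : 0 ≤ t) :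
    IntervalIntegrable f volume s t := by
  obtain ⟨C, hC⟩ := hf.2 (max s t + 1) (by positivity)
  refine (intervalIntegrable_const (c := C)).mono_fun hf.1.aestronglyMeasurable ?_
  refine (ae_restrict_mem measurableSet_uIoc).mono fun u hu => ?_
  refine (hC u ⟨(le_min hs ht).trans hu.1.le, hu.2.trans (by simp)⟩).trans (le_abs_self C)

theorem continuous_primitive [NormedSpace ℝ E] [SecondCountableTopology E]
    (hf : MeasurableLocallyBounded f) :
    Continuous fun t => ∫ s in (0 : ℝ)..max t 0, f s := by
  rw [continuous_iff_continuousAt]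
  intro t
  have hR : (0 : ℝ) ≤ |t| + 1 := by positivity
  have h := intervalIntegral.continuousOn_primitive_interval'
    (hf.intervalIntegrable le_rfl hR) Set.left_mem_uIcc
  rw [Set.uIcc_of_le hR] at h
  have hmaps : Set.MapsTo (fun u : ℝ => max u 0) (Set.Iic (|t| + 1)) (Set.Icc 0 (|t| + 1)) :=
    fun u hu => ⟨le_max_right _ _, max_le hu hR⟩
  exact (h.comp (by fun_prop) hmaps).continuousAt
    (Iic_mem_nhds (lt_of_le_of_lt (le_abs_self t) (lt_add_one _)))

end MeasurableLocallyBounded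

variable [NormedSpace ℝ E] [MeasurableSpace E] [BorelSpace E] [SecondCountableTopology E]

/-- The factorial gain in one step of Picard iteration. -/
theorem norm_integral_lipschitz_sub_le {b : E → E} {K : NNReal} (hb : LipschitzWith K b)
    {p q : ℝ → E} (hp : MeasurableLocallyBounded p) (hq : MeasurableLocallyBounded q)
    {C R : ℝ} {n : ℕ} (hpq : ∀ s ∈ Set.Icc 0 R, ‖p s - q s‖ ≤ C * ((K * s) ^ n / n.factorial))
    {t : ℝ} (ht : t ∈ Set.Icc 0 R) :
    ‖(∫ s in (0 : ℝ)..t, b (p s)) - ∫ s in (0 : ℝ)..t, b (q s)‖ ≤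
      C * ((K * t) ^ (n + 1) / (n + 1).factorial) := by
  rw [← intervalIntegral.integral_sub ((hp.comp_lipschitz hb).intervalIntegrable le_rfl ht.1)
    ((hq.comp_lipschitz hb).intervalIntegrable le_rfl ht.1)]
  calc ‖∫ s in (0 : ℝ)..t, (b (p s) - b (q s))‖
      ≤ ∫ s in (0 : ℝ)..t, (K * C * K ^ n / n.factorial) * s ^ n := by
        refine intervalIntegral.norm_integral_le_of_norm_le ht.1 (.of_forall fun s hs => ?_)
          (Continuous.intervalIntegrable (by fun_prop) _ _)
        calc ‖b (p s) - b (q s)‖ ≤ K * ‖p s - q s‖ := hb.norm_sub_le _ _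
          _ ≤ K * (C * ((K * s) ^ n / n.factorial)) := by
            gcongr
            exact hpq s ⟨hs.1.le, hs.2.trans ht.2⟩
          _ = _ := by rw [mul_pow]; ring
    _ = C * ((K * t) ^ (n + 1) / (n + 1).factorial) := by
        rw [intervalIntegral.integral_const_mul, integral_pow, Nat.factorial_succ]
        push_cast
        have : (n.factorial : ℝ) ≠ 0 := by positivity
        field_simp
        ring

/-- Uniqueness of locally bounded solutions of `X_t = a_t + ∫_0^t b(X_s) ds`. -/
theorem eq_of_integral_equation {b : E → E} {K : NNReal} (hb : LipschitzWith K b)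
    {a p q : ℝ → E} (hp : MeasurableLocallyBounded p) (hq : MeasurableLocallyBounded q)
    (hpe : ∀ t ≥ (0 : ℝ), p t = a t + ∫ s in (0 : ℝ)..t, b (p s))
    (hqe : ∀ t ≥ (0 : ℝ), q t = a t + ∫ s in (0 : ℝ)..t, b (q s))
    {t : ℝ} (ht : 0 ≤ t) : p t = q t := by
  obtain ⟨C, hC⟩ := hp.2 (t + 1) (by positivity)
  obtain ⟨D, hD⟩ := hq.2 (t + 1) (by positivity)
  have key (n : ℕ) : ∀ s ∈ Set.Icc 0 (t + 1),
      ‖p s - q s‖ ≤ (C + D) * ((K * s) ^ n / n.factorial) := by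
    induction n with
    | zero => exact fun s hs => by simpa using norm_sub_le_of_le (hC s hs) (hD s hs)
    | succ n ih =>
      intro s hs
      rw [hpe s hs.1, hqe s hs.1, add_sub_add_left_eq_sub]
      exact norm_integral_lipschitz_sub_le hb hp hq ih hs
  have hlim := (FloorSemiring.tendsto_pow_div_factorial_atTop ((K : ℝ) * t)).const_mul (C + D)
  rw [mul_zero] at hlim
  have h := ge_of_tendsto' hlim fun n => key n t ⟨ht, by linarith⟩
  exact sub_eq_zero.1 (norm_le_zero_iff.1 h)

/-- Picard iterates for `X_t = a_t + ∫_0^t b(X_s) ds`, with time frozen at `0` on the negative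
half-line. -/
noncomputable def picardIterate (b : E → E) (a : ℝ → E) : ℕ → ℝ → E
  | 0 => a
  | n + 1 => fun t => a t + ∫ s in (0 : ℝ)..max t 0, b (picardIterate b a n s)

theorem measurableLocallyBounded_picardIterate {b : E → E} {K : NNReal} (hb : LipschitzWith K b)
    {a : ℝ → E} (ha : MeasurableLocallyBounded a) (n : ℕ) :
    MeasurableLocallyBounded (picardIterate b a n) := by
  induction n with
  | zero => exact ha
  | succ n ih => exact ha.add (.of_continuous (ih.comp_lipschitz hb).continuous_primitive)

/-- Existence of a locally bounded solution of `X_t = a_t + ∫_0^t b(X_s) ds`. -/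
theorem exists_integral_equation [CompleteSpace E] {b : E → E} {K : NNReal}
    (hb : LipschitzWith K b) {a : ℝ → E} (ha : MeasurableLocallyBounded a)
    (ha_neg : ∀ t, a t = a (max t 0)) :
    ∃ X, MeasurableLocallyBounded X ∧
      ∀ t, X t = a t + ∫ s in (0 : ℝ)..max t 0, b (X s) := by
  set X := picardIterate b a with hX
  have hXm (n : ℕ) : MeasurableLocallyBounded (X n) :=
    measurableLocallyBounded_picardIterate hb ha n
  have hstep (R : ℝ) (hR : 0 < R) : ∃ u : ℕ → ℝ, Summable u ∧
      ∀ n, ∀ t ∈ Set.Icc 0 R, dist (X n t) (X (n + 1) t) ≤ u n := by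
    obtain ⟨C, hC⟩ := (hXm 0).2 R hR
    obtain ⟨D, hD⟩ := (hXm 1).2 R hR
    have key (n : ℕ) : ∀ s ∈ Set.Icc 0 R,
        ‖X n s - X (n + 1) s‖ ≤ (C + D) * ((K * s) ^ n / n.factorial) := by
      induction n with
      | zero => exact fun s hs => by simpa using norm_sub_le_of_le (hC s hs) (hD s hs)
      | succ n ih =>
        intro s hs
        have h := norm_integral_lipschitz_sub_le hb (hXm n) (hXm (n + 1)) ih hs
        have hrec (m : ℕ) : X (m + 1) s = a s + ∫ r in (0 : ℝ)..s, b (X m r) := by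
          simp [hX, picardIterate, max_eq_left hs.1]
        rwa [hrec n, hrec (n + 1), add_sub_add_left_eq_sub]
    have hCD : 0 ≤ C + D := (norm_nonneg _).trans
      (norm_sub_le_of_le (hC 0 ⟨le_rfl, hR.le⟩) (hD 0 ⟨le_rfl, hR.le⟩))
    refine ⟨fun n => (C + D) * ((K * R) ^ n / n.factorial),
      (Real.summable_pow_div_factorial _).mul_left _, fun n t ht => ?_⟩
    rw [dist_eq_norm]
    refine (key n t ht).trans ?_
    have := ht.1
    dsimp only
    gcongr
    exact ht.2
  have hfreeze (n : ℕ) (t : ℝ) : X n t = X n (max t 0) := by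
    cases n with
    | zero => exact ha_neg t
    | succ n => simp only [hX, picardIterate, max_assoc, max_self, ← ha_neg t]
  have hcauchy (t : ℝ) : ∃ y, Tendsto (fun n => X n t) atTop (nhds y) := by
    obtain ⟨u, hu, hXu⟩ := hstep (max t 0 + 1) (by positivity)
    refine cauchySeq_tendsto_of_complete (cauchySeq_of_dist_le_of_summable u (fun n => ?_) hu)
    rw [hfreeze n t, hfreeze (n + 1) t]
    exact hXu n _ ⟨le_max_right _ _, (lt_add_one _).le⟩
  choose Y hY using hcauchy
  have hunif (R : ℝ) (hR : 0 < R) : ∃ v : ℕ → ℝ, Tendsto v atTop (nhds 0) ∧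
      ∀ n, ∀ t ∈ Set.Icc 0 R, ‖X n t - Y t‖ ≤ v n := by
    obtain ⟨u, hu, hXu⟩ := hstep R hR
    refine ⟨fun n => ∑' m, u (n + m), ?_, fun n t ht => ?_⟩
    · simpa only [add_comm] using tendsto_sum_nat_add u
    · rw [← dist_eq_norm]
      exact dist_le_tsum_of_dist_le_of_tendsto u (fun n => hXu n t ht) hu (hY t) n
  have hYm : MeasurableLocallyBounded Y := by
    refine ⟨measurable_of_tendsto_metrizable (fun n => (hXm n).1) (tendsto_pi_nhds.2 hY),
      fun R hR => ?_⟩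
    obtain ⟨v, -, hv⟩ := hunif R hR
    obtain ⟨C, hC⟩ := (hXm 0).2 R hR
    refine ⟨C + v 0, fun t ht => ?_⟩
    simpa using norm_sub_le_of_le (hC t ht) (hv 0 t ht)
  refine ⟨Y, hYm, fun t => tendsto_nhds_unique ((tendsto_add_atTop_iff_nat 1).2 (hY t)) ?_⟩
  refine Tendsto.const_add (a t) ?_
  have hT : (0 : ℝ) ≤ max t 0 := le_max_right _ _
  obtain ⟨v, hv0, hv⟩ := hunif (max t 0 + 1) (by positivity)
  rw [tendsto_iff_norm_sub_tendsto_zero]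
  refine squeeze_zero (fun _ => norm_nonneg _) (fun n => ?_)
    (g := fun n => v n * ((K * max t 0) ^ 1 / (1 : ℕ).factorial)) ?_
  · exact norm_integral_lipschitz_sub_le hb (hXm n) hYm (n := 0)
      (fun s hs => by simpa using hv n s hs) ⟨hT, (lt_add_one _).le⟩
  · simpa only [zero_mul] using hv0.mul_const ((K * max t 0) ^ 1 / (1 : ℕ).factorial : ℝ)

end

/-- Existence and uniqueness for the deterministic integral equation
`X_t = x + ∫_0^t b(X_s) ds + g_t`, with `b` Lipschitz and `g` càdlàg, `g_0 = 0`: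
there is a unique measurable, locally bounded solution on `[0,∞)`, and it is càdlàg. -/
theorem stmt7 {d : ℕ} (b : EuclideanSpace ℝ (Fin d) → EuclideanSpace ℝ (Fin d))
    (K : NNReal) (hb : LipschitzWith K b)
    (g : ℝ → EuclideanSpace ℝ (Fin d)) (hg0 : g 0 = 0)
    (hgrc : ∀ t ≥ (0 : ℝ), ContinuousWithinAt g (Set.Ici t) t)
    (hgll : ∀ t > (0 : ℝ), ∃ y, Tendsto g (nhdsWithin t (Set.Iio t)) (nhds y))
    (x : EuclideanSpace ℝ (Fin d)) :
    ∃ X : ℝ → EuclideanSpace ℝ (Fin d),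
      Measurable X ∧
      (∀ R > (0 : ℝ), ∃ C, ∀ t ∈ Set.Icc (0 : ℝ) R, ‖X t‖ ≤ C) ∧
      (∀ t ≥ (0 : ℝ), X t = x + (∫ s in (0 : ℝ)..t, b (X s)) + g t) ∧
      (∀ t ≥ (0 : ℝ), ContinuousWithinAt X (Set.Ici t) t) ∧
      (∀ t > (0 : ℝ), ∃ y, Tendsto X (nhdsWithin t (Set.Iio t)) (nhds y)) ∧
      (∀ X' : ℝ → EuclideanSpace ℝ (Fin d),
        Measurable X' →
        (∀ R > (0 : ℝ), ∃ C, ∀ t ∈ Set.Icc (0 : ℝ) R, ‖X' t‖ ≤ C) →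
        (∀ t ≥ (0 : ℝ), X' t = x + (∫ s in (0 : ℝ)..t, b (X' s)) + g t) →
        ∀ t ≥ (0 : ℝ), X' t = X t) := by
  let a : ℝ → EuclideanSpace ℝ (Fin d) := fun t => x + g (max t 0)
  have ha_eq {t : ℝ} (ht : 0 ≤ t) : a t = x + g t := by simp [a, max_eq_left ht]
  have hg_rc (t : ℝ) : ContinuousWithinAt (fun t => g (max t 0)) (Set.Ici t) t :=
    (hgrc _ (le_max_right t 0)).comp (f := fun t : ℝ => max t 0) (by fun_prop)
      fun _ hu => max_le_max (Set.mem_Ici.1 hu) le_rfl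
  have ha : MeasurableLocallyBounded a := by
    refine (MeasurableLocallyBounded.of_continuous continuous_const).add
      ⟨measurable_of_continuousWithinAt_Ici hg_rc, fun R _ => ?_⟩
    obtain ⟨C, hC⟩ := exists_norm_le_of_cadlag hgrc hgll R
    exact ⟨C, fun t ht => by simpa [max_eq_left ht.1] using hC t ht⟩
  obtain ⟨X, hXm, hX⟩ := exists_integral_equation hb ha (fun t => by simp [a])
  have hX_eq (t : ℝ) (ht : t ≥ 0) : X t = a t + ∫ s in (0 : ℝ)..t, b (X s) := by
    simpa [max_eq_left ht] using hX t
  have hcont := (hXm.comp_lipschitz hb).continuous_primitive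
  refine ⟨X, hXm.1, hXm.2, fun t ht => ?_, fun t _ => ?_, fun t ht => ?_,
    fun X' hX'm hX'b hX' => ?_⟩
  · rw [hX_eq t ht, ha_eq ht, add_right_comm]
  · rw [funext hX]
    exact (continuousWithinAt_const.add (hg_rc t)).add hcont.continuousWithinAt
  · obtain ⟨y, hy⟩ := hgll t ht
    refine ⟨_, Tendsto.congr' ?_ ((tendsto_const_nhds (x := x)).add hy |>.add
      (hcont.tendsto t |>.mono_left nhdsWithin_le_nhds))⟩
    filter_upwards [mem_nhdsWithin_of_mem_nhds (Ioi_mem_nhds ht)] with u hu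
    rw [hX u, ha_eq (le_of_lt hu)]
  · refine fun t ht =>
      eq_of_integral_equation hb (a := a) ⟨hX'm, hX'b⟩ hXm (fun t ht => ?_) hX_eq ht
    rw [hX' t ht, ha_eq ht, add_right_comm]
end

section
/- Let f : ℝ^d → ℝ be continuously differentiable, let F : ℝ^d → ℝ^d be continuously differentiable such that the Jacobian matrix J(x) := ∇F(x) (with entries J_{ki}(x) = ∂_i F_k(x)) is invertible for every x, and assume that K := J^{-1} is continuously differentiable. Then for every j ∈ {1,…,d} and every x ∈ ℝ^d: (∂_j f)(F(x)) = Σ_{i=1}^d ∂_i ( f(F(·)) · K_{ij}(·) )(x) − f(F(x)) · Σ_{i=1}^d ∂_i K_{ij}(x). -/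
/-- Divergence identity for the inverse Jacobian (key step of Lemma 3.9): if `F : ℝ^d → ℝ^d`
is `C¹` with everywhere invertible Jacobian `J(x) = (∂_i F_k(x))_{ki}` whose inverse
`K = J⁻¹` is `C¹`, then for every `j` and `x`,
`(∂_j f)(F(x)) = Σ_i ∂_i (f(F(·)) K_{ij}(·))(x) − f(F(x)) Σ_i ∂_i K_{ij}(x)`. -/
theorem stmt11 {d : ℕ} (f : (Fin d → ℝ) → ℝ) (F : (Fin d → ℝ) → Fin d → ℝ)
    (hf : ContDiff ℝ 1 f) (hF : ContDiff ℝ 1 F)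
    (J : (Fin d → ℝ) → Matrix (Fin d) (Fin d) ℝ)
    (hJ : ∀ x, J x = Matrix.of fun k i => fderiv ℝ F x (Pi.single i 1) k)
    (hJinv : ∀ x, IsUnit (J x).det)
    (K : (Fin d → ℝ) → Matrix (Fin d) (Fin d) ℝ)
    (hK : ∀ x, K x = (J x)⁻¹)
    (hKreg : ∀ i j, ContDiff ℝ 1 fun x => K x i j) :
    ∀ (j : Fin d) (x : Fin d → ℝ),
      fderiv ℝ f (F x) (Pi.single j 1) =
        (∑ i, fderiv ℝ (fun y => f (F y) * K y i j) x (Pi.single i 1)) -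
          f (F x) * ∑ i, fderiv ℝ (fun y => K y i j) x (Pi.single i 1) := by
  intro j x
  have hcol : ∑ i, K x i j • fderiv ℝ F x (Pi.single i 1) = Pi.single j 1 := by
    have hJK : J x * K x = 1 := by rw [hK, Matrix.mul_nonsing_inv _ (hJinv x)]
    ext k
    have h := congrFun (congrFun hJK k) j
    rw [Matrix.mul_apply, hJ, Matrix.one_apply] at h
    simpa [Finset.sum_apply, Pi.single_apply, mul_comm] using h
  have hfF : DifferentiableAt ℝ f (F x) := hf.differentiable one_ne_zero _
  have hFx : DifferentiableAt ℝ F x := hF.differentiable one_ne_zero _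
  have hprod : ∀ i, fderiv ℝ (fun y => f (F y) * K y i j) x (Pi.single i 1) =
      f (F x) * fderiv ℝ (fun y => K y i j) x (Pi.single i 1) +
        K x i j * fderiv ℝ f (F x) (fderiv ℝ F x (Pi.single i 1)) := by
    intro i
    have h := (hfF.hasFDerivAt.comp x hFx.hasFDerivAt).mul
      ((hKreg i j).differentiable one_ne_zero x).hasFDerivAt
    have h' : HasFDerivAt (fun y => f (F y) * K y i j) _ x := h
    rw [h'.fderiv]
    simp
  simp_rw [hprod, Finset.sum_add_distrib, ← Finset.mul_sum, add_sub_cancel_left]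
  rw [← hcol, map_sum]
  simp
end

section
/- Let ν be a measure on (0,∞), let M > 0, λ > 0, and let r be a real number with 0 ≤ r ≤ M. Then (λ r / 2) · ∫_{(0, (log 2)/(λM)]} u ν(du) ≤ ∫_{(0,∞)} (1 − e^{−λ r u}) ν(du) ≤ ∫_{(0,∞)} min(1, λ M u) ν(du), where the inequalities are understood in [0, ∞]. -/
open MeasureTheory

theorem half_le_one_sub_exp_neg {x : ℝ} (h0 : 0 ≤ x) (h1 : x ≤ 1) :
    x / 2 ≤ 1 - Real.exp (-x) := by
  have hexp : Real.exp (-x) ≤ 1 / (1 + x) := by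
    rw [Real.exp_neg, ← one_div]
    exact one_div_le_one_div_of_le (by linarith) (by linarith [Real.add_one_le_exp x])
  have hfrac : 1 / (1 + x) ≤ 1 - x / 2 := by
    rw [div_le_iff₀ (by linarith)]
    nlinarith
  linarith

theorem one_sub_exp_neg_le_min (x : ℝ) : 1 - Real.exp (-x) ≤ min 1 x :=
  le_min (by linarith [Real.exp_pos (-x)]) (by linarith [Real.add_one_le_exp (-x)])

/-- Two-sided bounds on the Laplace exponent integrand (core of Lemma 3.1): for a measure
`ν` on `(0,∞)`, `M > 0`, `λ > 0` and `0 ≤ r ≤ M`,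
`(λr/2) ∫_{(0, log 2/(λM)]} u ν(du) ≤ ∫_{(0,∞)} (1 − e^{−λru}) ν(du)
  ≤ ∫_{(0,∞)} min(1, λMu) ν(du)`, in `[0,∞]`. -/
theorem stmt12 (ν : Measure ℝ) (M lam r : ℝ)
    (hM : 0 < M) (hlam : 0 < lam) (hr0 : 0 ≤ r) (hrM : r ≤ M) :
    ENNReal.ofReal (lam * r / 2) *
        (∫⁻ u in Set.Ioc (0 : ℝ) (Real.log 2 / (lam * M)), ENNReal.ofReal u ∂ν) ≤
      (∫⁻ u in Set.Ioi (0 : ℝ), ENNReal.ofReal (1 - Real.exp (-(lam * r * u))) ∂ν) ∧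
    (∫⁻ u in Set.Ioi (0 : ℝ), ENNReal.ofReal (1 - Real.exp (-(lam * r * u))) ∂ν) ≤
      ∫⁻ u in Set.Ioi (0 : ℝ), ENNReal.ofReal (min 1 (lam * M * u)) ∂ν := by
  constructor
  · rw [← lintegral_const_mul _ ENNReal.measurable_ofReal]
    refine (setLIntegral_mono' measurableSet_Ioc fun u hu => ?_).trans
      (lintegral_mono_set Set.Ioc_subset_Ioi_self)
    have hu0 : 0 ≤ u := hu.1.le
    have hu1 : u * (lam * M) ≤ Real.log 2 := (le_div_iff₀ (mul_pos hlam hM)).mp hu.2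
    have hle : lam * r * u ≤ lam * M * u := by gcongr
    rw [← ENNReal.ofReal_mul (by positivity)]
    refine ENNReal.ofReal_le_ofReal ?_
    have := half_le_one_sub_exp_neg (x := lam * r * u) (by positivity)
      (by linarith [Real.log_two_lt_d9])
    linarith
  · refine setLIntegral_mono' measurableSet_Ioi fun u hu => ENNReal.ofReal_le_ofReal ?_
    have hu0 : 0 ≤ u := le_of_lt hu
    exact (one_sub_exp_neg_le_min _).trans (min_le_min_left 1 (by gcongr))
end

section
/- Let A be an invertible d×d real matrix, let δ > 0, and let H : ℝ^d × ℝ^d → ℝ be twice continuously differentiable with all second-order partial derivatives bounded and with ∇²_{vv}H(x,v) ≥ δ·I (as symmetric matrices) for all (x,v) ∈ ℝ^d × ℝ^d. Define b : ℝ^{2d} → ℝ^{2d} by b(x,v) = (∇_v H(x,v), −∇_x H(x,v)), and let 𝔸 be the (2d)×d block matrix with upper block 0 and lower block A. Then inf_{(x,v) ∈ ℝ^{2d}} inf_{a ∈ ℝ^{2d}, ‖a‖=1} (‖a·𝔸‖² + ‖a·∇b(x,v)·𝔸‖²) > 0. -/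
/-- The gradient of `H` in the first (position) variable. -/
noncomputable def gradX {d : ℕ} (H : (Fin d → ℝ) × (Fin d → ℝ) → ℝ)
    (p : (Fin d → ℝ) × (Fin d → ℝ)) : Fin d → ℝ :=
  fun k => fderiv ℝ H p (Pi.single k 1, 0)

/-- The gradient of `H` in the second (velocity) variable. -/
noncomputable def gradV {d : ℕ} (H : (Fin d → ℝ) × (Fin d → ℝ) → ℝ)
    (p : (Fin d → ℝ) × (Fin d → ℝ)) : Fin d → ℝ :=
  fun k => fderiv ℝ H p (0, Pi.single k 1)

/-- The drift `b(x,v) = (∇_v H(x,v), −∇_x H(x,v))` of the Hamilton system,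
as a family of `2d` real-valued component functions indexed by `Fin d ⊕ Fin d`. -/
noncomputable def hamComp {d : ℕ} (H : (Fin d → ℝ) × (Fin d → ℝ) → ℝ)
    (k : Fin d ⊕ Fin d) (p : (Fin d → ℝ) × (Fin d → ℝ)) : ℝ :=
  Sum.elim (fun k' => gradV H p k') (fun k' => -(gradX H p k')) k

/-- The coordinate directions in `ℝ^d × ℝ^d ≅ ℝ^{2d}`. -/
noncomputable def hamDir {d : ℕ} (i : Fin d ⊕ Fin d) : (Fin d → ℝ) × (Fin d → ℝ) :=
  Sum.elim (fun i' => (Pi.single i' 1, (0 : Fin d → ℝ)))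
    (fun i' => ((0 : Fin d → ℝ), Pi.single i' 1)) i

/-- The `(2d)×(2d)` Jacobian matrix `∇b(x,v)` of the drift of the Hamilton system. -/
noncomputable def hamJac {d : ℕ} (H : (Fin d → ℝ) × (Fin d → ℝ) → ℝ)
    (p : (Fin d → ℝ) × (Fin d → ℝ)) : Matrix (Fin d ⊕ Fin d) (Fin d ⊕ Fin d) ℝ :=
  Matrix.of fun k i => fderiv ℝ (hamComp H k) p (hamDir i)

theorem sum_sq_vecMul_le {m n : Type*} [Fintype m] [Fintype n] (w : m → ℝ) (M : Matrix m n ℝ) :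
    ∑ j, Matrix.vecMul w M j ^ 2 ≤ (∑ j, ∑ k, M k j ^ 2) * ∑ k, w k ^ 2 := by
  rw [Finset.sum_mul]
  refine Finset.sum_le_sum fun j _ => ?_
  rw [mul_comm]
  exact Finset.sum_mul_sq_le_sq_mul_sq Finset.univ w fun k => M k j

theorem exists_sum_sq_le_mul_sum_sq_vecMul {d : ℕ} {A : Matrix (Fin d) (Fin d) ℝ} (hA : IsUnit A) :
    ∃ S > (0 : ℝ), ∀ w : Fin d → ℝ, ∑ j, w j ^ 2 ≤ S * ∑ j, Matrix.vecMul w A j ^ 2 := by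
  refine ⟨(∑ j, ∑ k, A⁻¹ k j ^ 2) + 1, by positivity, fun w => ?_⟩
  have h := sum_sq_vecMul_le (Matrix.vecMul w A) A⁻¹
  rw [Matrix.vecMul_vecMul, Matrix.mul_nonsing_inv A ((Matrix.isUnit_iff_isUnit_det A).1 hA),
    Matrix.vecMul_one] at h
  have : 0 ≤ ∑ j, Matrix.vecMul w A j ^ 2 := by positivity
  linarith

/-- If `⟪T, p⟫ ≥ δ ‖p‖²` then `‖T‖ ≥ δ ‖p‖`, in squared form. -/
theorem sq_mul_sum_sq_le_of_coercive {n : Type*} [Fintype n] {δ : ℝ} (hδ : 0 < δ)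
    {p T : n → ℝ} (h : δ * ∑ i, p i ^ 2 ≤ ∑ i, T i * p i) :
    δ ^ 2 * ∑ i, p i ^ 2 ≤ ∑ i, T i ^ 2 := by
  have h0 : 0 ≤ ∑ i, (T i - δ * p i) ^ 2 := by positivity
  have e : ∑ i, (T i - δ * p i) ^ 2
      = ∑ i, T i ^ 2 - 2 * δ * ∑ i, T i * p i + δ ^ 2 * ∑ i, p i ^ 2 := by
    simp only [Finset.mul_sum, ← Finset.sum_sub_distrib, ← Finset.sum_add_distrib]
    exact Finset.sum_congr rfl fun i _ => by ring
  nlinarith [mul_le_mul_of_nonneg_left h hδ.le]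

theorem sum_sq_le_two_mul_sum_sq_add {n : Type*} [Fintype n] (T U : n → ℝ) :
    ∑ i, T i ^ 2 ≤ 2 * ∑ i, (T + U) i ^ 2 + 2 * ∑ i, U i ^ 2 := by
  simp only [Finset.mul_sum, ← Finset.sum_add_distrib, Pi.add_apply]
  exact Finset.sum_le_sum fun i _ => by nlinarith [sq_nonneg (T i + 2 * U i)]

theorem exists_pos_le_sum_sq_vecMul {d : ℕ} {A : Matrix (Fin d) (Fin d) ℝ} (hA : IsUnit A)
    {δ : ℝ} (hδ : 0 < δ) {K : ℝ} (hK : 0 ≤ K) :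
    ∃ c > (0 : ℝ), ∀ (B M : Matrix (Fin d) (Fin d) ℝ) (p q : Fin d → ℝ),
      δ * ∑ i, p i ^ 2 ≤ ∑ i, Matrix.vecMul p B i * p i →
      ∑ j, ∑ k, M k j ^ 2 ≤ K →
      c * (∑ i, p i ^ 2 + ∑ i, q i ^ 2) ≤ ∑ j, Matrix.vecMul q A j ^ 2 +
        ∑ j, Matrix.vecMul (Matrix.vecMul p B + Matrix.vecMul q M) A j ^ 2 := by
  obtain ⟨S, hS, hSA⟩ := exists_sum_sq_le_mul_sum_sq_vecMul hA
  have hden : 0 < 2 * S * (1 + K + δ ^ 2) := by positivity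
  refine ⟨δ ^ 2 / (2 * S * (1 + K + δ ^ 2)), by positivity, fun B M p q hB hM => ?_⟩
  have h1 := sq_mul_sum_sq_le_of_coercive hδ hB
  have h2 := sum_sq_le_two_mul_sum_sq_add (Matrix.vecMul p B) (Matrix.vecMul q M)
  have hq0 : 0 ≤ ∑ i, q i ^ 2 := by positivity
  have h3 := (sum_sq_vecMul_le q M).trans (mul_le_mul_of_nonneg_right hM hq0)
  have h4 := hSA q
  have h5 := hSA (Matrix.vecMul p B + Matrix.vecMul q M)
  have hX : 0 ≤ ∑ j, Matrix.vecMul q A j ^ 2 := by positivity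
  have hY : 0 ≤ ∑ j, Matrix.vecMul (Matrix.vecMul p B + Matrix.vecMul q M) A j ^ 2 := by
    positivity
  rw [div_mul_eq_mul_div, div_le_iff₀ hden]
  generalize ∑ j, Matrix.vecMul q A j ^ 2 = X at *
  generalize ∑ j, Matrix.vecMul (Matrix.vecMul p B + Matrix.vecMul q M) A j ^ 2 = Y at *
  generalize ∑ i, q i ^ 2 = Q at *
  generalize ∑ i, p i ^ 2 = P at *
  have h6 : δ ^ 2 * P ≤ 2 * (S * Y) + 2 * (K * (S * X)) := by
    have := mul_le_mul_of_nonneg_left h4 hK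
    linarith
  have h7 : δ ^ 2 * Q ≤ δ ^ 2 * (S * X) := by gcongr
  have : 0 ≤ (S * Y) * (K + δ ^ 2) := by positivity
  have : 0 ≤ (S * X) * (1 + δ ^ 2) := by positivity
  have : 0 ≤ (S * X) * 1 := by positivity
  linarith

theorem vecMul_mul_fromRows_zero {m n : Type*} [Fintype m] [Fintype n] (a : m ⊕ n → ℝ)
    (J : Matrix (m ⊕ n) (m ⊕ n) ℝ) (A : Matrix n n ℝ) :
    Matrix.vecMul a (J * Matrix.fromRows (0 : Matrix m n ℝ) A)
      = Matrix.vecMul (Matrix.vecMul (a ∘ Sum.inl) J.toBlocks₁₂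
        + Matrix.vecMul (a ∘ Sum.inr) J.toBlocks₂₂) A := by
  conv_lhs => rw [← Matrix.vecMul_vecMul, ← J.fromBlocks_toBlocks]
  simp [Matrix.vecMul_fromBlocks, Matrix.vecMul_fromRows]

theorem hasFDerivAt_fderiv_apply {E : Type*} [NormedAddCommGroup E] [NormedSpace ℝ E] {H : E → ℝ}
    (hH : ContDiff ℝ 2 H) (p u : E) :
    HasFDerivAt (fun p => fderiv ℝ H p u) ((fderiv ℝ (fderiv ℝ H) p).flip u) p := by
  have hd : DifferentiableAt ℝ (fderiv ℝ H) p :=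
    ((hH.fderiv_right (m := 1) (by norm_num)).differentiable (by norm_num)) p
  simpa using hd.hasFDerivAt.clm_apply (hasFDerivAt_const u p)

section Hessian

variable {d : ℕ} {H : (Fin d → ℝ) × (Fin d → ℝ) → ℝ}

theorem hamJac_inl_inr (hH : ContDiff ℝ 2 H) (p : (Fin d → ℝ) × (Fin d → ℝ)) (k j : Fin d) :
    hamJac H p (Sum.inl k) (Sum.inr j)
      = fderiv ℝ (fderiv ℝ H) p (0, Pi.single j 1) (0, Pi.single k 1) := by
  have h := (hasFDerivAt_fderiv_apply hH p (0, Pi.single k 1)).fderiv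
  exact DFunLike.congr_fun h (0, Pi.single j 1)

theorem hamJac_inr_inr (hH : ContDiff ℝ 2 H) (p : (Fin d → ℝ) × (Fin d → ℝ)) (k j : Fin d) :
    hamJac H p (Sum.inr k) (Sum.inr j)
      = -fderiv ℝ (fderiv ℝ H) p (0, Pi.single j 1) (Pi.single k 1, 0) := by
  have h := (hasFDerivAt_fderiv_apply hH p (Pi.single k 1, 0)).neg.fderiv
  exact DFunLike.congr_fun h (0, Pi.single j 1)

theorem fderiv_fderiv_snd (hH : ContDiff ℝ 2 H) (x v w : Fin d → ℝ) :
    fderiv ℝ (fun v' => fderiv ℝ (fun u => H (x, u)) v' w) v w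
      = fderiv ℝ (fderiv ℝ H) (x, v) (0, w) (0, w) := by
  have h1 : (fun v' => fderiv ℝ (fun u => H (x, u)) v' w)
      = fun v' => fderiv ℝ H (x, v') (0, w) := by
    funext v'
    have h := ((hH.differentiable (by norm_num)) (x, v')).hasFDerivAt.comp v'
      (hasFDerivAt_prodMk_right x v')
    exact DFunLike.congr_fun h.fderiv w
  rw [h1]
  have h := (hasFDerivAt_fderiv_apply hH (x, v) (0, w)).comp v (hasFDerivAt_prodMk_right x v)
  exact DFunLike.congr_fun h.fderiv w

theorem sum_vecMul_hamJac_inl_inr (hH : ContDiff ℝ 2 H) (p : (Fin d → ℝ) × (Fin d → ℝ))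
    (w : Fin d → ℝ) :
    ∑ j, Matrix.vecMul w (hamJac H p).toBlocks₁₂ j * w j
      = fderiv ℝ (fderiv ℝ H) p (0, w) (0, w) := by
  have hw : ((0, w) : (Fin d → ℝ) × (Fin d → ℝ)) = ∑ i, w i • (0, Pi.single i 1) := by
    refine Prod.ext ?_ ?_
    · simp [Prod.fst_sum]
    · simpa [Prod.snd_sum] using pi_eq_sum_univ' w
  conv_rhs => rw [hw]
  simp only [map_sum, map_smul, sum_apply, smul_apply,
    smul_eq_mul, Matrix.vecMul, dotProduct, Matrix.toBlocks₁₂, Matrix.of_apply,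
    hamJac_inl_inr hH, Finset.sum_mul, Finset.mul_sum]
  rw [Finset.sum_comm]
  refine Finset.sum_congr rfl fun i _ => Finset.sum_congr rfl fun j _ => ?_
  ring

theorem sum_sq_hamJac_inr_inr_le (hH : ContDiff ℝ 2 H) {C : ℝ}
    {p : (Fin d → ℝ) × (Fin d → ℝ)} (hC : ‖fderiv ℝ (fderiv ℝ H) p‖ ≤ C) :
    ∑ j, ∑ k, (hamJac H p).toBlocks₂₂ k j ^ 2 ≤ ∑ _j : Fin d, ∑ _k : Fin d, C ^ 2 := by
  refine Finset.sum_le_sum fun j _ => Finset.sum_le_sum fun k _ => ?_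
  simp only [Matrix.toBlocks₂₂, Matrix.of_apply, hamJac_inr_inr hH, neg_sq]
  refine sq_le_sq' (neg_le_of_abs_le ?_) (le_of_abs_le ?_) <;>
  · refine ((fderiv ℝ (fderiv ℝ H) p).le_opNorm₂ _ _).trans ?_
    simpa [Prod.norm_def, Pi.norm_single] using hC

end Hessian

/-- For the stochastic Hamilton system with `A` invertible and `H` a `C²` Hamiltonian with
bounded second derivatives and `∇²_{vv}H ≥ δ·I`, the uniform Hörmander condition (UH₁)
holds: `inf_{(x,v)} inf_{‖a‖=1} (‖a·𝔸‖² + ‖a·∇b(x,v)·𝔸‖²) > 0`, where `𝔸 = (0, A)ᵀ`. -/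
theorem stmt14 {d : ℕ} (A : Matrix (Fin d) (Fin d) ℝ) (hA : IsUnit A)
    (δ : ℝ) (hδ : 0 < δ) (H : (Fin d → ℝ) × (Fin d → ℝ) → ℝ)
    (hH : ContDiff ℝ 2 H)
    (hH2bd : ∃ C, ∀ p, ‖fderiv ℝ (fderiv ℝ H) p‖ ≤ C)
    (hconv : ∀ (x v w : Fin d → ℝ),
      δ * ∑ i, w i ^ 2 ≤
        fderiv ℝ (fun v' => fderiv ℝ (fun u => H (x, u)) v' w) v w) :
    ∃ c > (0 : ℝ), ∀ (x v : Fin d → ℝ) (a : Fin d ⊕ Fin d → ℝ),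
      (∑ k, a k ^ 2) = 1 →
      c ≤ (∑ j, Matrix.vecMul a (Matrix.fromRows (0 : Matrix (Fin d) (Fin d) ℝ) A) j ^ 2) +
          ∑ j, Matrix.vecMul a
            (hamJac H (x, v) * Matrix.fromRows (0 : Matrix (Fin d) (Fin d) ℝ) A) j ^ 2 := by
  obtain ⟨C, hC⟩ := hH2bd
  obtain ⟨c, hc, h⟩ := exists_pos_le_sum_sq_vecMul hA hδ
    (K := ∑ _j : Fin d, ∑ _k : Fin d, C ^ 2) (by positivity)
  refine ⟨c, hc, fun x v a ha => ?_⟩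
  have hB : δ * ∑ i, (a ∘ Sum.inl) i ^ 2 ≤
      ∑ i, Matrix.vecMul (a ∘ Sum.inl) (hamJac H (x, v)).toBlocks₁₂ i * (a ∘ Sum.inl) i := by
    rw [sum_vecMul_hamJac_inl_inr hH, ← fderiv_fderiv_snd hH]
    exact hconv x v _
  have key := h _ _ _ (a ∘ Sum.inr) hB (sum_sq_hamJac_inr_inr_le hH (hC (x, v)))
  rw [Fintype.sum_sum_type] at ha
  simp only [Function.comp_apply, ha, mul_one] at key
  rw [vecMul_mul_fromRows_zero]
  simpa [Matrix.vecMul_fromRows] using key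
end
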